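/- (Sears' transformation for terminating balanced ₄φ₃ series.) Let n ∈ ℕ and q, A, B, C, D, E, F ∈ ℂ with q ≠ 0, A ≠ 0, B ≠ 0, C ≠ 0, and DEF = q^{1−n}ABC. Assume (q;q)_k ≠ 0, (D;q)_k ≠ 0, (E;q)_k ≠ 0, (F;q)_k ≠ 0, (q^{1−n}A/E;q)_k ≠ 0, and (q^{1−n}A/F;q)_k ≠ 0 for all k ≤ n. Then Σ_{k=0}^{n} [(q^{−n};q)_k (A;q)_k (B;q)_k (C;q)_k] / [(q;q)_k (D;q)_k (E;q)_k (F;q)_k] · q^k = A^n · [(E/A;q)_n (F/A;q)_n] / [(E;q)_n (F;q)_n] · Σ_{k=0}^{n} [(q^{−n};q)_k (A;q)_k (D/B;q)_k (D/C;q)_k] / [(q;q)_k (D;q)_k (q^{1−n}A/E;q)_k (q^{1−n}A/F;q)_k] · q^k. -/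

import Mathlib

open Finset

/-- q-shifted factorial `(a;q)_k = ∏_{j=0}^{k-1} (1 - a q^j)`. -/
noncomputable def qpoch (a q : ℂ) (k : ℕ) : ℂ := ∏ i ∈ Finset.range k, (1 - a * q ^ i)

lemma qpoch_succ (a q : ℂ) (k : ℕ) : qpoch a q (k + 1) = qpoch a q k * (1 - a * q ^ k) :=
  Finset.prod_range_succ _ _

lemma qpoch_zero (a q : ℂ) : qpoch a q 0 = 1 := Finset.prod_range_zero _

lemma qpoch_add (a q : ℂ) (j m : ℕ) :
    qpoch a q (j + m) = qpoch a q j * qpoch (a * q ^ j) q m := by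
  unfold qpoch
  rw [Finset.prod_range_add]
  congr 1
  exact Finset.prod_congr rfl fun i _ => by ring

lemma qpoch_succ' (a q : ℂ) (k : ℕ) :
    qpoch a q (k + 1) = (1 - a) * qpoch (a * q) q k := by
  rw [add_comm, qpoch_add, qpoch_succ, qpoch_zero]
  simp

/-- The `j`-th term of the `q`-Pfaff–Saalschütz sum of order `k`, normalised so that it is
polynomial in `x`, `u`, `v`. -/
noncomputable def saalTerm (q x u v : ℂ) (k j : ℕ) : ℂ :=
  x ^ j * qpoch u q j * qpoch v q j * qpoch (x * u * v * q ^ j) q (k - j) * qpoch x q (k - j) /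
    (qpoch q q j * qpoch q q (k - j))

lemma saalTerm_partial_sum (q x u v : ℂ) (k : ℕ) (hqq : ∀ i ≤ k + 1, qpoch q q i ≠ 0) (m : ℕ)
    (hm : m ≤ k) :
    (1 - q ^ (k + 1)) * ∑ j ∈ range (m + 1), saalTerm q x u v (k + 1) j -
      (1 - x * u * q ^ k) * (1 - x * v * q ^ k) * ∑ j ∈ range (m + 1), saalTerm q x u v k j =
      -(x * q ^ (k - m) * (1 - u * q ^ m) * (1 - v * q ^ m)) * saalTerm q x u v k m := by
  induction m with
  | zero =>
    have h1 := hqq (k + 1) le_rfl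
    rw [qpoch_succ] at h1
    have h2 := left_ne_zero_of_mul h1
    have h3 := right_ne_zero_of_mul h1
    simp only [zero_add, sum_range_one, saalTerm, Nat.sub_zero, qpoch_succ, qpoch_zero, pow_zero,
      mul_one, one_mul]
    rw [show q ^ (k + 1) = q * q ^ k by ring]
    field_simp
    ring
  | succ m ih =>
    obtain ⟨i, rfl⟩ : ∃ i, k = m + 1 + i := ⟨k - (m + 1), by omega⟩
    have ih := ih (by omega)
    rw [sum_range_succ, sum_range_succ (saalTerm q x u v (m + 1 + i)) (m + 1)]
    have h1 := hqq (i + 1) (by omega)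
    have h2 := hqq (m + 1) (by omega)
    rw [qpoch_succ] at h1 h2
    have h3 := left_ne_zero_of_mul h1
    have h4 := right_ne_zero_of_mul h1
    have h5 := left_ne_zero_of_mul h2
    have h6 := right_ne_zero_of_mul h2
    rw [mul_add, mul_add, add_sub_add_comm, ih]
    simp only [saalTerm, show m + 1 + i - m = i + 1 by omega,
      show m + 1 + i + 1 - (m + 1) = i + 1 by omega, show m + 1 + i - (m + 1) = i by omega]
    rw [qpoch_succ' (x * u * v * q ^ m), qpoch_succ (x * u * v * q ^ (m + 1)),
      show x * u * v * q ^ m * q = x * u * v * q ^ (m + 1) by ring]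
    simp only [qpoch_succ]
    generalize qpoch (x * u * v * q ^ (m + 1)) q i = P
    simp only [pow_add, pow_one]
    generalize q ^ m = M at *
    generalize q ^ i = I at *
    have h7 : 1 - I * q ≠ 0 := by rwa [mul_comm]
    have h8 : 1 - M * q ≠ 0 := by rwa [mul_comm]
    field_simp
    ring

/-- The `q`-Pfaff–Saalschütz sum in polynomial form. -/
lemma sum_saalTerm (q x u v : ℂ) (k : ℕ) (hqq : ∀ i ≤ k, qpoch q q i ≠ 0) :
    ∑ j ∈ range (k + 1), saalTerm q x u v k j =
      qpoch (x * u) q k * qpoch (x * v) q k / qpoch q q k := by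
  induction k with
  | zero => simp [saalTerm, qpoch_zero]
  | succ k ih =>
    have h := saalTerm_partial_sum q x u v k hqq k le_rfl
    have ih := ih fun i hi => hqq i (by omega)
    have h1 := hqq (k + 1) le_rfl
    rw [qpoch_succ] at h1
    have h2 := left_ne_zero_of_mul h1
    have h3 := right_ne_zero_of_mul h1
    have h4 : 1 - q ^ (k + 1) ≠ 0 := by rwa [pow_succ']
    rw [sum_range_succ]
    apply mul_left_cancel₀ h4
    rw [mul_add, eq_add_of_sub_eq h, ih]
    simp only [saalTerm, Nat.sub_self, qpoch_zero, pow_zero, qpoch_succ]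
    rw [show q ^ (k + 1) = q * q ^ k by ring]
    generalize q ^ k = K at *
    have h5 : 1 - K * q ≠ 0 := by rwa [mul_comm]
    field_simp
    ring

/-- The factor produced by reversing the first `k` of `N` factors of a `q`-shifted factorial. -/
noncomputable def revFactor (q : ℂ) (N k : ℕ) : ℂ := ∏ i ∈ range k, -q ^ ((N : ℤ) - 1 - i)

lemma revFactor_succ (q : ℂ) (N k : ℕ) :
    revFactor q N (k + 1) = revFactor q N k * -q ^ ((N : ℤ) - 1 - k) :=
  Finset.prod_range_succ _ _

lemma revFactor_ne_zero {q : ℂ} (hq : q ≠ 0) (N k : ℕ) : revFactor q N k ≠ 0 :=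
  Finset.prod_ne_zero_iff.2 fun _ _ => neg_ne_zero.2 (zpow_ne_zero _ hq)

lemma revFactor_sq {q : ℂ} (hq : q ≠ 0) (m k : ℕ) :
    revFactor q (k + m) k ^ 2 * (q ^ (1 - ((k + m : ℕ) : ℤ))) ^ k = q ^ (k * m) := by
  have key : ∀ (N : ℤ) (j : ℕ),
      (∏ i ∈ range j, -q ^ (N - 1 - i)) ^ 2 = q ^ ((j : ℤ) * (2 * N - 1 - j)) := by
    intro N j
    induction j with
    | zero => simp
    | succ j ih =>
      rw [prod_range_succ, mul_pow, ih, neg_sq, ← zpow_natCast (q ^ _) 2, ← zpow_mul,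
        ← zpow_add₀ hq]
      congr 1
      push_cast
      ring
  rw [revFactor, key, ← zpow_natCast (q ^ _) k, ← zpow_mul, ← zpow_add₀ hq, ← zpow_natCast]
  congr 1
  push_cast
  ring

lemma qpoch_reverse {q y : ℂ} (hq : q ≠ 0) (hy : y ≠ 0) (m k : ℕ) :
    qpoch y q (k + m) =
      qpoch (q ^ (1 - ((k + m : ℕ) : ℤ)) / y) q k * qpoch y q m * y ^ k *
        revFactor q (k + m) k := by
  suffices h : ∀ (N : ℕ) (k m : ℕ), k + m = N → qpoch y q N =
      qpoch (q ^ (1 - (N : ℤ)) / y) q k * qpoch y q m * y ^ k * revFactor q N k from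
    h _ _ _ rfl
  intro N k
  induction k with
  | zero =>
    intro m hm
    obtain rfl : m = N := by omega
    simp [qpoch_zero, revFactor]
  | succ k ih =>
    intro m hm
    rw [ih (m + 1) (by omega), qpoch_succ, qpoch_succ, revFactor_succ, pow_succ]
    have e1 : (N : ℤ) - 1 - k = m := by omega
    have e2 : q ^ (1 - (N : ℤ)) * q ^ k * q ^ m = 1 := by
      rw [← zpow_natCast, ← zpow_natCast, ← zpow_add₀ hq, ← zpow_add₀ hq]
      rw [show 1 - (N : ℤ) + k + m = 0 by omega, zpow_zero]
    have e3 : (1 - q ^ (1 - (N : ℤ)) / y * q ^ k) * (y * -q ^ m) = 1 - y * q ^ m := by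
      field_simp
      linear_combination e2
    rw [e1, zpow_natCast, ← e3]
    ring

/-- The `q`-Pfaff–Saalschütz sum for a terminating balanced `₃φ₂` series. -/
lemma qPfaffSaalschutz (N : ℕ) (q a x e f : ℂ) (hq : q ≠ 0) (ha : a ≠ 0) (hf : f ≠ 0)
    (hbal : e * f = q ^ (1 - (N : ℤ)) * a * x)
    (hqq : ∀ k ≤ N, qpoch q q k ≠ 0) (he : ∀ k ≤ N, qpoch e q k ≠ 0)
    (hf' : ∀ k ≤ N, qpoch f q k ≠ 0) :
    ∑ m ∈ range (N + 1), qpoch (q ^ (-(N : ℤ))) q m * qpoch a q m * qpoch x q m /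
        (qpoch q q m * qpoch e q m * qpoch f q m) * q ^ m =
      a ^ N * (qpoch (e / a) q N * qpoch (f / a) q N) / (qpoch e q N * qpoch f q N) := by
  obtain ⟨y, hy⟩ : ∃ y, y = q ^ (1 - (N : ℤ)) / f := ⟨_, rfl⟩
  have hqN : q ^ (1 - (N : ℤ)) ≠ 0 := zpow_ne_zero _ hq
  have hy0 : y ≠ 0 := hy ▸ div_ne_zero hqN hf
  have hyax : y * a * x = e := by
    rw [hy]
    field_simp
    linear_combination -hbal
  have hyx : y * x = e / a := by
    rw [← hyax]
    field_simp
  have hfy : q ^ (1 - (N : ℤ)) / y = f := by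
    rw [hy]
    field_simp
  have r1 := qpoch_reverse hq hf 0 N
  have r2 := qpoch_reverse hq (div_ne_zero hf ha) 0 N
  simp only [add_zero, qpoch_zero, mul_one] at r1 r2
  rw [← hy] at r1
  rw [show q ^ (1 - (N : ℤ)) / (f / a) = y * a by rw [hy]; field_simp] at r2
  have hfN := hf' N le_rfl
  have hyN : qpoch y q N ≠ 0 := by
    intro h
    rw [h] at r1
    simp [r1] at hfN
  have hs := sum_saalTerm q y a x N hqq
  have hterm : ∀ m ∈ range (N + 1), saalTerm q y a x N m =
      qpoch y q N * qpoch e q N / qpoch q q N *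
        (qpoch (q ^ (-(N : ℤ))) q m * qpoch a q m * qpoch x q m /
        (qpoch q q m * qpoch e q m * qpoch f q m) * q ^ m) := by
    intro m hm
    obtain ⟨i, rfl⟩ : ∃ i, N = m + i := ⟨N - m, by have := mem_range.1 hm; omega⟩
    have r3 := qpoch_reverse hq hy0 i m
    have r4 := qpoch_reverse hq hq i m
    rw [hfy] at r3
    rw [show q ^ (1 - ((m + i : ℕ) : ℤ)) / q = q ^ (-((m + i : ℕ) : ℤ)) by
      rw [sub_eq_add_neg, zpow_add₀ hq, zpow_one]; field_simp] at r4
    have h1 := hqq m (by omega)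
    have h2 := hqq i (by omega)
    have h3 := hqq (m + i) le_rfl
    have h4 := he m (by omega)
    have h5 := hf' m (by omega)
    have h6 := revFactor_ne_zero hq (m + i) m
    rw [saalTerm, hyax, Nat.add_sub_cancel_left, qpoch_add e, r3]
    field_simp
    rw [r4]
    ring
  rw [sum_congr rfl hterm, ← mul_sum, hyx] at hs
  have h3 := hqq N le_rfl
  have h4 := he N le_rfl
  have h6 := revFactor_ne_zero hq N N
  have key : a ^ N * qpoch (f / a) q N * qpoch y q N = qpoch (y * a) q N * qpoch f q N := by
    rw [r1, r2, div_pow]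
    field_simp
  rw [eq_div_iff (mul_ne_zero h4 hfN)]
  apply mul_left_cancel₀ hyN
  revert hs
  generalize (∑ m ∈ range (N + 1), _ : ℂ) = S
  intro hs
  field_simp at hs
  linear_combination qpoch f q N * hs - qpoch (e / a) q N * key

/-- The inner sum arising after expanding two of the numerator factors of a balanced `₄φ₃` series
by the `q`-Pfaff–Saalschütz sum and interchanging the summations. -/
lemma sum_shifted_saalschutz (j N : ℕ) (q A E F x : ℂ) (hq : q ≠ 0) (hA : A ≠ 0) (hx0 : x ≠ 0)
    (hE0 : E ≠ 0) (hF0 : F ≠ 0) (hEF : E * F = q ^ (1 - ((j + N : ℕ) : ℤ)) * A * x)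
    (hqq : ∀ k ≤ j + N, qpoch q q k ≠ 0)
    (hE : ∀ k ≤ j + N, qpoch E q k ≠ 0) (hF : ∀ k ≤ j + N, qpoch F q k ≠ 0)
    (h1 : qpoch (q ^ (1 - ((j + N : ℕ) : ℤ)) * A / E) q j ≠ 0)
    (h2 : qpoch (q ^ (1 - ((j + N : ℕ) : ℤ)) * A / F) q j ≠ 0) :
    ∑ m ∈ range (N + 1), qpoch (q ^ (-((j + N : ℕ) : ℤ))) q (j + m) * qpoch A q (j + m) *
        qpoch x q m / (qpoch q q m * qpoch E q (j + m) * qpoch F q (j + m)) * q ^ (j + m) =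
      qpoch (q ^ (-((j + N : ℕ) : ℤ))) q j * qpoch A q j * q ^ j *
        (A ^ (j + N) * (qpoch (E / A) q (j + N) * qpoch (F / A) q (j + N)) /
          (qpoch E q (j + N) * qpoch F q (j + N))) /
        (x ^ j * qpoch (q ^ (1 - ((j + N : ℕ) : ℤ)) * A / E) q j *
          qpoch (q ^ (1 - ((j + N : ℕ) : ℤ)) * A / F) q j) := by
  have hshift : ∀ {a : ℂ}, (∀ k ≤ j + N, qpoch a q k ≠ 0) →
      ∀ k ≤ N, qpoch (a * q ^ j) q k ≠ 0 := by
    intro a h k hk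
    have := h (j + k) (by omega)
    rw [qpoch_add] at this
    exact right_ne_zero_of_mul this
  have hqj : q ^ j ≠ 0 := pow_ne_zero _ hq
  have hsum := qPfaffSaalschutz N q (A * q ^ j) x (E * q ^ j) (F * q ^ j) hq
    (mul_ne_zero hA hqj) (mul_ne_zero hF0 hqj) (by
      have : q ^ (1 - (N : ℤ)) = q ^ (1 - ((j + N : ℕ) : ℤ)) * q ^ j := by
        rw [← zpow_natCast q j, ← zpow_add₀ hq]
        congr 1
        push_cast
        ring
      rw [this]
      linear_combination q ^ j * q ^ j * hEF) (fun k hk => hqq k (by omega)) (hshift hE) (hshift hF)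
  rw [mul_div_mul_right _ _ hqj, mul_div_mul_right _ _ hqj] at hsum
  have hneg : q ^ (-((j + N : ℕ) : ℤ)) * q ^ j = q ^ (-(N : ℤ)) := by
    rw [← zpow_natCast q j, ← zpow_add₀ hq]
    congr 1
    push_cast
    ring
  have hinner : ∀ m ∈ range (N + 1),
      qpoch (q ^ (-((j + N : ℕ) : ℤ))) q (j + m) * qpoch A q (j + m) * qpoch x q m /
          (qpoch q q m * qpoch E q (j + m) * qpoch F q (j + m)) * q ^ (j + m) =
      qpoch (q ^ (-((j + N : ℕ) : ℤ))) q j * qpoch A q j * q ^ j / (qpoch E q j * qpoch F q j) *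
        (qpoch (q ^ (-(N : ℤ))) q m * qpoch (A * q ^ j) q m * qpoch x q m /
          (qpoch q q m * qpoch (E * q ^ j) q m * qpoch (F * q ^ j) q m) * q ^ m) := by
    intro m _
    simp only [qpoch_add, hneg, pow_add, div_eq_mul_inv, mul_inv]
    ring
  rw [sum_congr rfl hinner, ← mul_sum, hsum]
  have rE := qpoch_reverse hq (div_ne_zero hE0 hA) N j
  have rF := qpoch_reverse hq (div_ne_zero hF0 hA) N j
  rw [div_div_eq_mul_div] at rE rF
  have hs := revFactor_sq hq N j
  have h5 := hE j (by omega)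
  have h6 := hF j (by omega)
  have h7 := hshift hE N le_rfl
  have h8 := hshift hF N le_rfl
  have hpow : A ^ j * ((E / A) ^ j * (F / A) ^ j) * revFactor q (j + N) j ^ 2 =
      x ^ j * q ^ (j * N) := by
    rw [← hs, ← mul_pow, ← mul_pow, show A * (E / A * (F / A)) = E * F / A by field_simp, hEF,
      show q ^ (1 - ((j + N : ℕ) : ℤ)) * A * x / A = q ^ (1 - ((j + N : ℕ) : ℤ)) * x by
        field_simp, mul_pow]
    ring
  rw [rE, rF, qpoch_add E, qpoch_add F, mul_pow A, ← pow_mul, pow_add A]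
  generalize qpoch (q ^ (1 - ((j + N : ℕ) : ℤ)) * A / E) q j = PE at *
  generalize qpoch (q ^ (1 - ((j + N : ℕ) : ℤ)) * A / F) q j = PF at *
  generalize qpoch (E / A) q N = QE
  generalize qpoch (F / A) q N = QF
  generalize qpoch (q ^ (-((j + N : ℕ) : ℤ))) q j * qpoch A q j * q ^ j = P
  rw [div_mul_div_comm, mul_div_assoc', div_div, div_eq_div_iff
    (mul_ne_zero (mul_ne_zero h5 h6) (mul_ne_zero h7 h8))
    (mul_ne_zero (mul_ne_zero (mul_ne_zero h5 h7) (mul_ne_zero h6 h8))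
      (mul_ne_zero (mul_ne_zero (pow_ne_zero _ hx0) h1) h2))]
  generalize (E / A) ^ j = X at *
  generalize (F / A) ^ j = Y at *
  linear_combination -(P * A ^ N * QE * QF * PE * PF * qpoch E q j * qpoch F q j *
    qpoch (E * q ^ j) q N * qpoch (F * q ^ j) q N) * hpow

theorem sears_transformation (n : ℕ) (q A B C D E F : ℂ)
    (hq : q ≠ 0) (hA : A ≠ 0) (hB : B ≠ 0) (hC : C ≠ 0)
    (hbal : D * E * F = q ^ (1 - (n : ℤ)) * A * B * C)
    (hqq : ∀ k : ℕ, k ≤ n → qpoch q q k ≠ 0)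
    (hD : ∀ k : ℕ, k ≤ n → qpoch D q k ≠ 0)
    (hE : ∀ k : ℕ, k ≤ n → qpoch E q k ≠ 0)
    (hF : ∀ k : ℕ, k ≤ n → qpoch F q k ≠ 0)
    (hE' : ∀ k : ℕ, k ≤ n → qpoch (q ^ (1 - (n : ℤ)) * A / E) q k ≠ 0)
    (hF' : ∀ k : ℕ, k ≤ n → qpoch (q ^ (1 - (n : ℤ)) * A / F) q k ≠ 0) :
    ∑ k ∈ Finset.range (n + 1),
        (qpoch (q ^ (-(n : ℤ))) q k * qpoch A q k * qpoch B q k * qpoch C q k) /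
          (qpoch q q k * qpoch D q k * qpoch E q k * qpoch F q k) * q ^ k
      = A ^ n * (qpoch (E / A) q n * qpoch (F / A) q n) / (qpoch E q n * qpoch F q n) *
          ∑ k ∈ Finset.range (n + 1),
            (qpoch (q ^ (-(n : ℤ))) q k * qpoch A q k * qpoch (D / B) q k * qpoch (D / C) q k) /
              (qpoch q q k * qpoch D q k * qpoch (q ^ (1 - (n : ℤ)) * A / E) q k *
                qpoch (q ^ (1 - (n : ℤ)) * A / F) q k) * q ^ k := by
  have hqn : q ^ (1 - (n : ℤ)) ≠ 0 := zpow_ne_zero _ hq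
  have hDEF : D * E * F ≠ 0 := by
    rw [hbal]
    exact mul_ne_zero (mul_ne_zero (mul_ne_zero hqn hA) hB) hC
  have hF0 : F ≠ 0 := right_ne_zero_of_mul hDEF
  have hE0 : E ≠ 0 := right_ne_zero_of_mul (left_ne_zero_of_mul hDEF)
  have hD0 : D ≠ 0 := left_ne_zero_of_mul (left_ne_zero_of_mul hDEF)
  obtain ⟨x, hx⟩ : ∃ x, x = B * C / D := ⟨_, rfl⟩
  have hx0 : x ≠ 0 := hx ▸ div_ne_zero (mul_ne_zero hB hC) hD0
  have hEF : E * F = q ^ (1 - (n : ℤ)) * A * x := by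
    rw [hx]
    field_simp
    linear_combination hbal
  obtain ⟨u, hu⟩ : ∃ u, u = D / B := ⟨_, rfl⟩
  obtain ⟨v, hv⟩ : ∃ v, v = D / C := ⟨_, rfl⟩
  have hC' : x * u = C := by rw [hx, hu]; field_simp
  have hB' : x * v = B := by rw [hx, hv]; field_simp
  have hD' : x * u * v = D := by rw [hC', hv]; field_simp
  rw [← hu, ← hv]
  -- expand `(B;q)_k (C;q)_k` by the polynomial Saalschütz sum
  have hexp : ∀ k ∈ range (n + 1),
      (qpoch (q ^ (-(n : ℤ))) q k * qpoch A q k * qpoch B q k * qpoch C q k) /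
          (qpoch q q k * qpoch D q k * qpoch E q k * qpoch F q k) * q ^ k =
      ∑ j ∈ range (k + 1), x ^ j * qpoch u q j * qpoch v q j / (qpoch q q j * qpoch D q j) *
        (qpoch (q ^ (-(n : ℤ))) q k * qpoch A q k * qpoch x q (k - j) /
          (qpoch q q (k - j) * qpoch E q k * qpoch F q k) * q ^ k) := by
    intro k hk
    have hk' : k ≤ n := by have := mem_range.1 hk; omega
    have hs := sum_saalTerm q x u v k fun i hi => hqq i (by omega)
    rw [hC', hB'] at hs
    have h1 := hD k hk'
    have h2 := hqq k hk'
    have h3 := hE k hk'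
    have h4 := hF k hk'
    trans qpoch (q ^ (-(n : ℤ))) q k * qpoch A q k / (qpoch D q k * qpoch E q k * qpoch F q k) *
      q ^ k * ∑ j ∈ range (k + 1), saalTerm q x u v k j
    · rw [hs]
      field_simp
    rw [mul_sum]
    refine sum_congr rfl fun j hj => ?_
    obtain ⟨i, rfl⟩ : ∃ i, k = j + i := ⟨k - j, by have := mem_range.1 hj; omega⟩
    have h5 := hqq j (by omega)
    have h6 := hqq i (by omega)
    have h7 := hD j (by omega)
    rw [qpoch_add D] at h1
    have h8 := right_ne_zero_of_mul h1
    rw [saalTerm, hD', Nat.add_sub_cancel_left, qpoch_add D]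
    field_simp
  rw [sum_congr rfl hexp, mul_sum]
  rw [Finset.sum_sigma' (range (n + 1)) (fun k => range (k + 1))]
  trans ∑ j ∈ range (n + 1), ∑ m ∈ range (n - j + 1),
      x ^ j * qpoch u q j * qpoch v q j / (qpoch q q j * qpoch D q j) *
        (qpoch (q ^ (-(n : ℤ))) q (j + m) * qpoch A q (j + m) * qpoch x q m /
          (qpoch q q m * qpoch E q (j + m) * qpoch F q (j + m)) * q ^ (j + m))
  · rw [Finset.sum_sigma' (range (n + 1)) (fun j => range (n - j + 1))]
    refine Finset.sum_bij' (fun p _ => ⟨p.2, p.1 - p.2⟩) (fun p _ => ⟨p.1 + p.2, p.1⟩)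
      ?_ ?_ ?_ ?_ ?_
    · rintro ⟨k, j⟩ h
      simp only [mem_sigma, mem_range] at h ⊢
      omega
    · rintro ⟨j, m⟩ h
      simp only [mem_sigma, mem_range] at h ⊢
      omega
    · rintro ⟨k, j⟩ h
      simp only [mem_sigma, mem_range] at h
      simp only [show j + (k - j) = k by omega]
    · rintro ⟨j, m⟩ h
      simp only [Nat.add_sub_cancel_left]
    · rintro ⟨k, j⟩ h
      simp only [mem_sigma, mem_range] at h
      simp only [show j + (k - j) = k by omega]
  refine sum_congr rfl fun j hj => ?_
  obtain ⟨N, rfl⟩ : ∃ N, n = j + N := ⟨n - j, by have := mem_range.1 hj; omega⟩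
  rw [Nat.add_sub_cancel_left, ← mul_sum]
  rw [sum_shifted_saalschutz j N q A E F x hq hA hx0 hE0 hF0 hEF hqq hE hF (hE' j (by omega))
    (hF' j (by omega))]
  generalize A ^ (j + N) * (qpoch (E / A) q (j + N) * qpoch (F / A) q (j + N)) /
    (qpoch E q (j + N) * qpoch F q (j + N)) = S
  have hxj : x ^ j ≠ 0 := pow_ne_zero _ hx0
  field_simp
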